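/- Let m be a positive integer and let r_0, r_1, …, r_m be nonnegative real numbers. Set R := r_0 + r_1 + ⋯ + r_m and R' := r_1 + ⋯ + r_m, and assume R ≥ 1 and R' < 1. Then V(r_0,…,r_m) := R / ∏_{j=0}^m (1 + r_j) satisfies V(r_0,…,r_m) ≥ (1 + 1/(m+1))^{−(m+1)}. -/

import Mathlib

lemma amgm_aux (n : ℕ) (hn : 0 < n) (z : ℕ → ℝ) (hz : ∀ i ∈ Finset.range n, 0 ≤ z i) :
    ∏ i ∈ Finset.range n, z i ≤ ((∑ i ∈ Finset.range n, z i) / n) ^ n := by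
  have hn' : (0 : ℝ) < n := by exact_mod_cast hn
  have h := Real.geom_mean_le_arith_mean (Finset.range n) (fun _ => (1 : ℝ)) z
    (fun _ _ => zero_le_one) (by simpa using hn) hz
  simp only [Real.rpow_one, one_mul, Finset.sum_const, Finset.card_range, nsmul_eq_mul,
    mul_one] at h
  have hp : 0 ≤ ∏ i ∈ Finset.range n, z i := Finset.prod_nonneg hz
  have h2 := pow_le_pow_left₀ (Real.rpow_nonneg hp _) h n
  rwa [Real.rpow_inv_natCast_pow hp hn.ne'] at h2

/-- Corollary 1 of the paper: for nonnegative odds `r₀, r₁, …, r_m` with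
`R = r₀ + ⋯ + r_m ≥ 1` and `R' = r₁ + ⋯ + r_m < 1`, the success probability
`V = R / ∏ (1 + r_j)` satisfies `V ≥ (1 + 1/(m+1))^{-(m+1)}`. -/
theorem odds_lower_bound_corollary (m : ℕ) (hm : 0 < m) (r : ℕ → ℝ)
    (hr : ∀ j ≤ m, 0 ≤ r j)
    (hR : 1 ≤ ∑ j ∈ Finset.range (m + 1), r j)
    (hR' : ∑ j ∈ Finset.Icc 1 m, r j < 1) :
    ((1 + 1 / ((m : ℝ) + 1)) ^ (m + 1))⁻¹ ≤
      (∑ j ∈ Finset.range (m + 1), r j) / ∏ j ∈ Finset.range (m + 1), (1 + r j) := by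
  have hS : ∑ j ∈ Finset.Icc 1 m, r j = ∑ j ∈ Finset.range m, r (j + 1) := by
    rw [Finset.range_eq_Ico, Finset.sum_Ico_add' r 0 m 1]
    rfl
  rw [hS] at hR'
  rw [Finset.sum_range_succ'] at hR ⊢
  rw [Finset.prod_range_succ']
  have hx : 0 ≤ r 0 := hr 0 (Nat.zero_le _)
  have hrs : ∀ i ∈ Finset.range m, 0 < 1 + r (i + 1) := fun i hi => by
    have := hr (i + 1) (by have := Finset.mem_range.1 hi; omega)
    linarith
  have hP : 0 < ∏ i ∈ Finset.range m, (1 + r (i + 1)) := Finset.prod_pos hrs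
  set S := ∑ j ∈ Finset.range m, r (j + 1) with hSdef
  have key := amgm_aux (m + 1) (Nat.succ_pos m)
    (fun j => if j = 0 then 2 - S else 1 + r j) (by
      intro i hi
      have := Finset.mem_range.1 hi
      have h2 := hr i (by omega)
      split_ifs <;> linarith)
  rw [Finset.prod_range_succ', Finset.sum_range_succ'] at key
  simp only [Nat.add_eq_zero_iff, one_ne_zero, and_false, if_false, if_true,
    Finset.sum_add_distrib, Finset.sum_const, Finset.card_range, nsmul_eq_mul, mul_one,
    ← hSdef] at key
  set P := ∏ i ∈ Finset.range m, (1 + r (i + 1)) with hPdef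
  have e : ((m : ℝ) + S + (2 - S)) / ((m + 1 : ℕ) : ℝ) = 1 + 1 / ((m : ℝ) + 1) := by
    have : (m : ℝ) + 1 ≠ 0 := by positivity
    push_cast
    field_simp
    ring
  rw [e] at key
  have h2S : 0 < P * (2 - S) := mul_pos hP (by linarith)
  refine (inv_anti₀ h2S key).trans ?_
  rw [inv_eq_one_div, div_le_div_iff₀ h2S (by positivity)]
  have : 1 + r 0 ≤ (S + r 0) * (2 - S) := by
    nlinarith [mul_nonneg (sub_nonneg.2 hR) (sub_nonneg.2 hR'.le)]
  nlinarith [mul_le_mul_of_nonneg_left this hP.le]
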